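/- arXiv:1003.2272 — 3 statements merged into one kernel-verified Lean document; each statement's English description precedes it below -/
import Mathlib

section
/- Suppose G is a rank 3 group satisfying Hypothesis (*) such that H has a unique minimal normal subgroup T which is a nonabelian simple group, the degree n of X is at least 3, and G ∩ T^n is a full diagonal subgroup of T^n. Then for α ∈ B there exist automorphisms ψ and ψ′ of T such that the three subgroups T_α, (T_α)^ψ and (T_α)^{ψ′} are pairwise non-conjugate in T; in particular, T has at least three conjugacy classes of subgroups that are images of the point stabiliser T_α under automorphisms of T. -/
/-- The subgroup `K ≤ Sym(α)` is `2`-transitive on `α` (acting on at least two points). -/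
def Is2Trans {α : Type*} (K : Subgroup (Equiv.Perm α)) : Prop :=
  Nontrivial α ∧ ∀ a b c d : α, a ≠ b → c ≠ d → ∃ g ∈ K, g a = c ∧ g b = d

/-- Membership in the imprimitive wreath product `H ≀ X ≤ Sym(α × ι)`:
`g` has the form `(b, i) ↦ (hᵢ b, x i)` with each `hᵢ ∈ H` and `x ∈ X`. -/
def InWreath {α ι : Type*} (H : Subgroup (Equiv.Perm α)) (X : Subgroup (Equiv.Perm ι))
    (g : Equiv.Perm (α × ι)) : Prop :=
  ∃ (h : ι → Equiv.Perm α) (x : Equiv.Perm ι),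
    (∀ i, h i ∈ H) ∧ x ∈ X ∧ ∀ p : α × ι, g p = (h p.2 p.1, x p.2)

/-- The projection of `G` to `Sym(ι)` (the group induced on the block system) equals `X`. -/
def ProjEq {α ι : Type*} (G : Subgroup (Equiv.Perm (α × ι)))
    (X : Subgroup (Equiv.Perm ι)) : Prop :=
  ∀ x : Equiv.Perm ι, x ∈ X ↔ ∃ g ∈ G, ∀ p : α × ι, (g p).2 = x p.2

/-- The component of `G` (the permutation group induced on the block `α × {i₀}` by its
setwise stabiliser in `G`) equals `H`. -/
def ComponentEq {α ι : Type*} (G : Subgroup (Equiv.Perm (α × ι))) (i₀ : ι)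
    (H : Subgroup (Equiv.Perm α)) : Prop :=
  ∀ σ : Equiv.Perm α, σ ∈ H ↔ ∃ g ∈ G, ∀ b : α, g (b, i₀) = (σ b, i₀)

/-- `N` is a normal subgroup of `K`, both regarded as subgroups of `Sym(α)`. -/
def NormalIn {α : Type*} (N K : Subgroup (Equiv.Perm α)) : Prop :=
  N ≤ K ∧ ∀ g ∈ K, ∀ x ∈ N, g * x * g⁻¹ ∈ N

/-- `T` is a minimal normal subgroup of `K`. -/
def IsMinimalNormalIn {α : Type*} (T K : Subgroup (Equiv.Perm α)) : Prop :=
  NormalIn T K ∧ T ≠ ⊥ ∧ ∀ N : Subgroup (Equiv.Perm α), NormalIn N K → N ≠ ⊥ → N ≤ T → N = T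

/-- `g` lies in the base group `T^n ≤ Sym(α × ι)`: it has the form `(b, i) ↦ (tᵢ b, i)`
with each `tᵢ ∈ T`. -/
def InBase {α ι : Type*} (T : Subgroup (Equiv.Perm α)) (g : Equiv.Perm (α × ι)) : Prop :=
  ∃ t : ι → Equiv.Perm α, (∀ i, t i ∈ T) ∧ ∀ p : α × ι, g p = (t p.2 p.1, p.2)

/-- The set `{g | P g}` (a set of elements of the base group of `Sym(α) ≀ Sym(ι)`) is a
full diagonal subgroup of `L^n`: every coordinate projection maps it bijectively onto `L`. -/
def IsFullDiagonal {α ι : Type*} (P : Equiv.Perm (α × ι) → Prop)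
    (L : Subgroup (Equiv.Perm α)) : Prop :=
  (∀ (i : ι) (σ : Equiv.Perm α), σ ∈ L ↔ ∃ g, P g ∧ ∀ b : α, g (b, i) = (σ b, i)) ∧
  (∀ (i : ι) (g g' : Equiv.Perm (α × ι)), P g → P g' →
    (∀ b : α, g (b, i) = g' (b, i)) → g = g')

/-- Two subgroups of `G` are conjugate in `G`. -/
def AreConjIn {G : Type*} [Group G] (A A' : Subgroup G) : Prop :=
  ∃ g : G, Subgroup.map (MulAut.conj g).toMonoidHom A = A'

open Equiv in
/-- The permutations in `G` lying in the base group with coordinates in `T`. -/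
def baseIntersection {α ι : Type*} (G : Subgroup (Perm (α × ι))) (T : Subgroup (Perm α)) :
    Subgroup (Perm (α × ι)) where
  carrier := {g | g ∈ G ∧ InBase T g}
  one_mem' := ⟨G.one_mem, fun _ => 1, fun _ => T.one_mem, fun _ => rfl⟩
  mul_mem' := by
    rintro a b ⟨ha, s, hs, has⟩ ⟨hb, t, ht, hbt⟩
    exact ⟨G.mul_mem ha hb, fun i => s i * t i, fun i => T.mul_mem (hs i) (ht i), fun p => by
      rw [Perm.mul_apply, hbt, has]; rfl⟩
  inv_mem' := by
    rintro a ⟨ha, s, hs, has⟩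
    exact ⟨G.inv_mem ha, fun i => (s i)⁻¹, fun i => T.inv_mem (hs i), fun p => by
      rw [Perm.inv_eq_iff_eq, has]; simp⟩

section BaseIntersection

variable {α ι : Type*} {G : Subgroup (Equiv.Perm (α × ι))} {T : Subgroup (Equiv.Perm α)}

/-- The projection of the base intersection to its `i`-th coordinate. -/
noncomputable def coordHom (G : Subgroup (Equiv.Perm (α × ι))) (T : Subgroup (Equiv.Perm α))
    (i : ι) : baseIntersection G T →* T :=
  MonoidHom.mk' (fun m => ⟨m.2.2.choose i, m.2.2.choose_spec.1 i⟩) fun a b => by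
    ext x
    have h := (a * b).2.2.choose_spec.2 (x, i)
    have ha := a.2.2.choose_spec.2 (b.2.2.choose i x, i)
    have hb := b.2.2.choose_spec.2 (x, i)
    exact (congrArg Prod.fst
      (h.symm.trans ((congrArg (a : Equiv.Perm (α × ι)) hb).trans ha)))

theorem apply_eq_coordHom (m : baseIntersection G T) (b : α) (i : ι) :
    (m : Equiv.Perm (α × ι)) (b, i) = ((coordHom G T i m : Equiv.Perm α) b, i) :=
  m.2.2.choose_spec.2 (b, i)

theorem coordHom_bijective
    (hdiag : IsFullDiagonal (fun g => g ∈ G ∧ InBase T g) T) (i : ι) :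
    Function.Bijective (coordHom G T i) := by
  refine ⟨fun a b hab => Subtype.ext (hdiag.2 i a b a.2 b.2 fun x => ?_), fun t => ?_⟩
  · rw [apply_eq_coordHom, apply_eq_coordHom, hab]
  · obtain ⟨g, hg, hgt⟩ := (hdiag.1 i t).1 t.2
    refine ⟨⟨g, hg⟩, Subtype.ext (Equiv.ext fun x => ?_)⟩
    have h := apply_eq_coordHom (G := G) (T := T) ⟨g, hg⟩ x i
    rw [hgt] at h
    exact (congrArg Prod.fst h).symm

/-- The `i`-th coordinate projection of a full diagonal subgroup, as an isomorphism. -/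
noncomputable def coordEquiv (hdiag : IsFullDiagonal (fun g => g ∈ G ∧ InBase T g) T) (i : ι) :
    baseIntersection G T ≃* T :=
  MulEquiv.ofBijective (coordHom G T i) (coordHom_bijective hdiag i)

theorem apply_eq_coordEquiv (hdiag : IsFullDiagonal (fun g => g ∈ G ∧ InBase T g) T)
    (m : baseIntersection G T) (b : α) (i : ι) :
    (m : Equiv.Perm (α × ι)) (b, i) = ((coordEquiv hdiag i m : Equiv.Perm α) b, i) :=
  apply_eq_coordHom m b i

theorem conj_mem_baseIntersection {H : Subgroup (Equiv.Perm α)} {X : Subgroup (Equiv.Perm ι)}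
    (hT : NormalIn T H) {g m : Equiv.Perm (α × ι)} (hgG : g ∈ G) (hg : InWreath H X g)
    (hm : m ∈ baseIntersection G T) : g * m * g⁻¹ ∈ baseIntersection G T := by
  obtain ⟨h, x, hh, -, hgx⟩ := hg
  obtain ⟨hmG, t, ht, hmt⟩ := hm
  refine ⟨G.mul_mem (G.mul_mem hgG hmG) (G.inv_mem hgG),
    fun j => h (x⁻¹ j) * t (x⁻¹ j) * (h (x⁻¹ j))⁻¹, fun j => hT.2 _ (hh _) _ (ht _), fun p => ?_⟩
  obtain ⟨q, rfl⟩ := g.surjective p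
  rw [Equiv.Perm.mul_apply, Equiv.Perm.mul_apply, show g⁻¹ (g q) = q from g.symm_apply_apply q,
    hmt, hgx, hgx]
  simp

/-- Two points have the same stabiliser in `M`. -/
def SameStabilizer {Ω : Type*} (M : Subgroup (Equiv.Perm Ω)) (p q : Ω) : Prop :=
  ∀ m ∈ M, m p = p ↔ m q = q

theorem SameStabilizer.map {Ω : Type*} {M : Subgroup (Equiv.Perm Ω)} {g : Equiv.Perm Ω}
    (hg : ∀ m ∈ M, g⁻¹ * m * g ∈ M) {p q : Ω} (h : SameStabilizer M p q) :
    SameStabilizer M (g p) (g q) := by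
  intro m hm
  have := h _ (hg m hm)
  simpa [Equiv.Perm.mul_apply, Equiv.symm_apply_eq] using this

theorem not_areConjIn_of_forall_not_sameStabilizer
    (hdiag : IsFullDiagonal (fun g => g ∈ G ∧ InBase T g) T) (a : α) (k i j : ι)
    (h : ∀ b c : α, ¬ SameStabilizer (baseIntersection G T) (b, i) (c, j)) :
    ¬ AreConjIn
      (Subgroup.map ((coordEquiv hdiag i).symm.trans (coordEquiv hdiag k)).toMonoidHom
        (MulAction.stabilizer T a))
      (Subgroup.map ((coordEquiv hdiag j).symm.trans (coordEquiv hdiag k)).toMonoidHom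
        (MulAction.stabilizer T a)) := by
  rintro ⟨g, hg⟩
  obtain ⟨r, rfl⟩ := (coordEquiv hdiag k).surjective g
  have mem_iff (l : ι) (m : baseIntersection G T) : coordEquiv hdiag k m ∈
      Subgroup.map ((coordEquiv hdiag l).symm.trans (coordEquiv hdiag k)).toMonoidHom
        (MulAction.stabilizer T a) ↔ (m : Equiv.Perm (α × ι)) (a, l) = (a, l) := by
    rw [apply_eq_coordEquiv hdiag, Prod.mk_left_inj]
    constructor
    · rintro ⟨t, ht, htm⟩
      have htm' : coordEquiv hdiag k ((coordEquiv hdiag l).symm t) = coordEquiv hdiag k m := htm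
      rw [← (coordEquiv hdiag k).injective htm', MulEquiv.apply_symm_apply]
      exact ht
    · intro hm
      exact ⟨coordEquiv hdiag l m, hm,
        congrArg (coordEquiv hdiag k) ((coordEquiv hdiag l).symm_apply_apply m)⟩
  refine h ((coordEquiv hdiag i r : Equiv.Perm α) a) a fun m hm => ?_
  have hconj : coordEquiv hdiag k ⟨m, hm⟩ ∈ Subgroup.map
      ((coordEquiv hdiag j).symm.trans (coordEquiv hdiag k)).toMonoidHom
        (MulAction.stabilizer T a) ↔ coordEquiv hdiag k (r⁻¹ * ⟨m, hm⟩ * r) ∈ Subgroup.map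
      ((coordEquiv hdiag i).symm.trans (coordEquiv hdiag k)).toMonoidHom
        (MulAction.stabilizer T a) := by
    rw [← hg, Subgroup.mem_map_equiv, map_mul, map_mul, map_inv, MulAut.conj_symm_apply]
  rw [mem_iff, mem_iff] at hconj
  rw [← apply_eq_coordEquiv hdiag]
  simpa [Equiv.Perm.mul_apply, Equiv.symm_apply_eq] using hconj.symm

end BaseIntersection

/-- A nontrivial normal subgroup of a `2`-transitive group that acts semiregularly is a
`p`-group. -/
theorem exists_isPGroup_of_semiregular {α : Type*} [Finite α] {H T : Subgroup (Equiv.Perm α)}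
    (hH : Is2Trans H) (hT : NormalIn T H) (hne : T ≠ ⊥)
    (hfree : ∀ t ∈ T, ∀ a, t a = a → t = 1) : ∃ p : ℕ, p.Prime ∧ IsPGroup p T := by
  have : Nontrivial α := hH.1
  obtain ⟨a⟩ := (inferInstance : Nonempty α)
  have : Nontrivial T := (Subgroup.nontrivial_iff_ne_bot T).2 hne
  have hcard : Nat.card T ≠ 1 := Finite.one_lt_card.ne'
  obtain ⟨p, hp, hdvd⟩ := Nat.exists_prime_and_dvd hcard
  have : Fact p.Prime := ⟨hp⟩
  obtain ⟨t, ht⟩ := exists_prime_orderOf_dvd_card' p hdvd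
  have ht1 : (t : Equiv.Perm α) ≠ 1 := by
    intro h
    rw [OneMemClass.coe_eq_one.1 h, orderOf_one] at ht
    exact hp.one_lt.ne ht
  have htp : (t : Equiv.Perm α) ^ p = 1 := by
    rw [← ht, ← Subgroup.coe_pow, pow_orderOf_eq_one, Subgroup.coe_one]
  refine ⟨p, hp, fun s => ⟨1, ?_⟩⟩
  by_cases hs1 : (s : Equiv.Perm α) = 1
  · rw [OneMemClass.coe_eq_one.1 hs1, one_pow]
  obtain ⟨h, hh, hha, hht⟩ := hH.2 a ((t : Equiv.Perm α) a) a ((s : Equiv.Perm α) a)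
    (fun h => ht1 (hfree t t.2 a h.symm)) (fun h => hs1 (hfree s s.2 a h.symm))
  have hconj : h * t * h⁻¹ = (s : Equiv.Perm α) := by
    have hfix := hfree _ (T.mul_mem (T.inv_mem s.2) (hT.2 h hh t t.2)) a (by
      have : h⁻¹ a = a := by rw [Equiv.Perm.inv_eq_iff_eq, hha]
      simp [Equiv.Perm.mul_apply, this, hht])
    exact (inv_mul_eq_one.1 hfix).symm
  apply Subtype.ext
  rw [pow_one, Subgroup.coe_pow, ← hconj, conj_pow, htp]
  simp

theorem commute_of_isPGroup_of_isSimpleGroup {K : Type*} [Group K] [Finite K] [IsSimpleGroup K]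
    {p : ℕ} (hp : p.Prime) (hK : IsPGroup p K) (x y : K) : x * y = y * x := by
  have : Fact p.Prime := ⟨hp⟩
  have hc := hK.center_nontrivial
  have htop : Subgroup.center K = ⊤ :=
    (Subgroup.Normal.eq_bot_or_eq_top inferInstance).resolve_left
      ((Subgroup.nontrivial_iff_ne_bot _).1 hc)
  have hx : y ∈ Subgroup.center K := htop ▸ Subgroup.mem_top y
  exact Subgroup.mem_center_iff.1 hx x

/-- A rank `3` group preserving the blocks `α × {i}` is transitive on pairs of points in
different blocks. -/
theorem exists_map_pair_of_rank_three {α ι : Type*} [Nontrivial α]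
    {G : Subgroup (Equiv.Perm (α × ι))}
    (hblock : ∀ g ∈ G, ∀ p q : α × ι, (g p).2 = (g q).2 ↔ p.2 = q.2)
    (hrank : Nat.card (MulAction.orbitRel.Quotient G ((α × ι) × (α × ι))) = 3)
    {p q p' q' : α × ι} (h : p.2 ≠ q.2) (h' : p'.2 ≠ q'.2) :
    ∃ g ∈ G, g p = p' ∧ g q = q' := by
  classical
  let f : (α × ι) × (α × ι) → Fin 3 := fun r =>
    if r.1 = r.2 then 0 else if r.1.2 = r.2.2 then 1 else 2
  have hf (r s) (hrs : MulAction.orbitRel G ((α × ι) × (α × ι)) r s) : f r = f s := by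
    obtain ⟨g, rfl⟩ := hrs
    have h1 := hblock g g.2 s.1 s.2
    have h2 := (g : Equiv.Perm (α × ι)).injective.eq_iff (a := s.1) (b := s.2)
    change (if (g : Equiv.Perm (α × ι)) s.1 = (g : Equiv.Perm (α × ι)) s.2 then 0 else
      if ((g : Equiv.Perm (α × ι)) s.1).2 = ((g : Equiv.Perm (α × ι)) s.2).2 then 1 else 2) = f s
    simp only [h1, h2, f]
  let F : MulAction.orbitRel.Quotient G ((α × ι) × (α × ι)) → Fin 3 := Quotient.lift f hf
  obtain ⟨a, b, hab⟩ := exists_pair_ne α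
  have hsurj : Function.Surjective F := by
    intro c
    fin_cases c
    · exact ⟨Quotient.mk _ (p, p), by simp [F, f]⟩
    · exact ⟨Quotient.mk _ ((a, p.2), (b, p.2)), by simp [F, f, hab]⟩
    · exact ⟨Quotient.mk _ (p, q), by simp [F, f, h, ne_of_apply_ne Prod.snd h]⟩
  have : Finite (MulAction.orbitRel.Quotient G ((α × ι) × (α × ι))) :=
    Nat.finite_of_card_ne_zero (by omega)
  have hinj : Function.Injective F :=
    ((Nat.bijective_iff_surjective_and_card F).2 ⟨hsurj, by simp [hrank]⟩).1
  have heq : F (Quotient.mk _ (p', q')) = F (Quotient.mk _ (p, q)) := by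
    simp [F, f, h, h', ne_of_apply_ne Prod.snd h, ne_of_apply_ne Prod.snd h']
  obtain ⟨g, hg⟩ := Quotient.exact (hinj heq)
  exact ⟨g, g.2, congrArg Prod.fst hg, congrArg Prod.snd hg⟩

/-- suppose `G` is a rank 3 group satisfying Hypothesis (*) such that the
unique minimal normal subgroup `T` of `H` is nonabelian simple, `n ≥ 3`, and `G ∩ Tⁿ`
is a full diagonal subgroup of `Tⁿ`. Then for every `α ∈ B` there are automorphisms
`ψ, ψ'` of `T` such that `T_α`, `T_α^ψ` and `T_α^{ψ'}` are pairwise non-conjugate in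
`T`; in particular `T` has at least three conjugacy classes of subgroups that are
images of the point stabiliser `T_α` under automorphisms of `T`. -/
theorem stmt_9 {B : Type*} [Fintype B] {n : ℕ} (hn : 3 ≤ n)
    (H T : Subgroup (Equiv.Perm B)) (X : Subgroup (Equiv.Perm (Fin n)))
    (hH : Is2Trans H) (hX : Is2Trans X)
    (G : Subgroup (Equiv.Perm (B × Fin n)))
    (hGw : ∀ g ∈ G, InWreath H X g)
    (hproj : ProjEq G X)
    (hcomp : ComponentEq G (⟨0, by omega⟩ : Fin n) H)
    (hT : IsMinimalNormalIn T H)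
    (hTuniq : ∀ T' : Subgroup (Equiv.Perm B), IsMinimalNormalIn T' H → T' = T)
    (hTsimple : IsSimpleGroup T)
    (hTnonab : ∃ x y : T, x * y ≠ y * x)
    (hrank3 : Nat.card
      (MulAction.orbitRel.Quotient G ((B × Fin n) × (B × Fin n))) = 3)
    (hdiag : IsFullDiagonal (fun g => g ∈ G ∧ InBase T g) T) :
    ∀ α : B, ∃ ψ ψ' : T ≃* T,
      ¬ AreConjIn (MulAction.stabilizer T α)
          (Subgroup.map ψ.toMonoidHom (MulAction.stabilizer T α)) ∧
      ¬ AreConjIn (MulAction.stabilizer T α)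
          (Subgroup.map ψ'.toMonoidHom (MulAction.stabilizer T α)) ∧
      ¬ AreConjIn (Subgroup.map ψ.toMonoidHom (MulAction.stabilizer T α))
          (Subgroup.map ψ'.toMonoidHom (MulAction.stabilizer T α)) := by
  intro α
  have : Nontrivial B := hH.1
  have hnorm (g) (hg : g ∈ G) (m) (hm : m ∈ baseIntersection G T) :
      g⁻¹ * m * g ∈ baseIntersection G T := by
    simpa using conj_mem_baseIntersection hT.1 (G.inv_mem hg) (hGw _ (G.inv_mem hg)) hm
  have hblock (g) (hg : g ∈ G) (p q : B × Fin n) : (g p).2 = (g q).2 ↔ p.2 = q.2 := by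
    obtain ⟨h, x, -, -, hgx⟩ := hGw g hg
    rw [hgx, hgx]
    exact x.injective.eq_iff
  have hnot (p q : B × Fin n) (hpq : p.2 ≠ q.2) :
      ¬ SameStabilizer (baseIntersection G T) p q := by
    intro hsame
    have hall (p' q' : B × Fin n) (h' : p'.2 ≠ q'.2) :
        SameStabilizer (baseIntersection G T) p' q' := by
      obtain ⟨g, hg, rfl, rfl⟩ := exists_map_pair_of_rank_three hblock hrank3 hpq h'
      exact hsame.map (hnorm g hg)
    have hfree (t) (ht : t ∈ T) (a : B) (hta : t a = a) : t = 1 := by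
      obtain ⟨g, hg, hgt⟩ := (hdiag.1 p.2 t).1 ht
      ext b
      have h1 := (hall (a, p.2) (α, q.2) hpq g hg).1 (by rw [hgt, hta])
      have h2 := (hall (b, p.2) (α, q.2) hpq g hg).2 h1
      rw [hgt] at h2
      exact congrArg Prod.fst h2
    obtain ⟨r, hr, hrT⟩ := exists_isPGroup_of_semiregular hH hT.1 hT.2.1 hfree
    obtain ⟨x, y, hxy⟩ := hTnonab
    exact hxy (commute_of_isPGroup_of_isSimpleGroup hr hrT x y)
  have hnonconj (i j : Fin n) (hij : i ≠ j) :=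
    not_areConjIn_of_forall_not_sameStabilizer hdiag α ⟨0, by omega⟩ i j
      fun b c => hnot (b, i) (c, j) hij
  have hself (i : Fin n) : Subgroup.map
      ((coordEquiv hdiag i).symm.trans (coordEquiv hdiag i)).toMonoidHom
        (MulAction.stabilizer T α) = MulAction.stabilizer T α := by
    rw [MulEquiv.symm_trans_self]
    exact Subgroup.map_id _
  have h01 := hnonconj ⟨0, by omega⟩ ⟨1, by omega⟩ (by simp)
  have h02 := hnonconj ⟨0, by omega⟩ ⟨2, by omega⟩ (by simp)
  rw [hself] at h01 h02
  exact ⟨_, _, h01, h02, hnonconj ⟨1, by omega⟩ ⟨2, by omega⟩ (by simp)⟩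
end

section
/- Suppose that G ≤ Sym(Ω) satisfies Hypothesis (*), with system of imprimitivity 𝓑 consisting of n blocks of size m. Then G has rank 3 if and only if both of the following hold: (A) for all distinct blocks B, B′ ∈ 𝓑, the stabiliser G_{B,B′} of both blocks acts transitively on B × B′; and (B) for every B ∈ 𝓑 and v ∈ B, the point stabiliser G_v acts transitively on 𝓑 \ {B}. -/
/-- If `t` is a surjective invariant of a group action on a finite type, there are exactly as many
orbits as values of `t` if and only if `t` separates the orbits. -/
theorem card_orbits_eq_card_iff {G α κ : Type*} [Group G] [MulAction G α] [Finite α]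
    (t : α → κ) (ht : ∀ (g : G) x, t (g • x) = t x) (hs : Function.Surjective t) :
    Nat.card (MulAction.orbitRel.Quotient G α) = Nat.card κ ↔
      ∀ x y, t x = t y → ∃ g : G, g • x = y := by
  let f : MulAction.orbitRel.Quotient G α → κ := Quotient.lift t (by
    rintro a b ⟨g, rfl⟩
    exact ht g b)
  have hf : Function.Surjective f := fun k => by
    obtain ⟨x, rfl⟩ := hs k
    exact ⟨Quotient.mk _ x, rfl⟩
  have : Finite (MulAction.orbitRel.Quotient G α) := Quotient.finite _
  have hκ : Finite κ := Finite.of_surjective t hs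
  constructor
  · intro hc x y hxy
    have hb : Function.Bijective f := (Nat.bijective_iff_surjective_and_card f).2 ⟨hf, hc⟩
    have h : (Quotient.mk _ y : MulAction.orbitRel.Quotient G α) = Quotient.mk _ x :=
      hb.1 hxy.symm
    exact Quotient.exact h
  · intro h
    refine Nat.card_eq_of_bijective f ⟨?_, hf⟩
    rintro ⟨x⟩ ⟨y⟩ hxy
    obtain ⟨g, hg⟩ := h y x hxy.symm
    exact Quotient.sound ⟨g, hg⟩

theorem Is2Trans.exists_apply_eq {α : Type*} {K : Subgroup (Equiv.Perm α)} (hK : Is2Trans K)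
    (a c : α) : ∃ g ∈ K, g a = c := by
  have := hK.1
  obtain ⟨b, hb⟩ := exists_ne a
  obtain ⟨d, hd⟩ := exists_ne c
  obtain ⟨g, hg, h, -⟩ := hK.2 a b c d hb.symm hd.symm
  exact ⟨g, hg, h⟩

theorem InWreath.snd_eq_iff {α ι : Type*} {H : Subgroup (Equiv.Perm α)}
    {X : Subgroup (Equiv.Perm ι)} {g : Equiv.Perm (α × ι)} (hg : InWreath H X g) (p q : α × ι) :
    (g p).2 = (g q).2 ↔ p.2 = q.2 := by
  obtain ⟨h, x, -, -, hgx⟩ := hg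
  simp [hgx]

/-- Moving pairs of points of a block to pairs of points of another block, when the component and
the projection are `2`-transitive. -/
theorem exists_map_pair_of_same_block {α ι : Type*} {H : Subgroup (Equiv.Perm α)}
    {X : Subgroup (Equiv.Perm ι)} (hH : Is2Trans H) (hX : Is2Trans X)
    {G : Subgroup (Equiv.Perm (α × ι))} (hproj : ProjEq G X) {i₀ : ι}
    (hcomp : ComponentEq G i₀ H) {a b c d : α} (hab : a ≠ b) (hcd : c ≠ d) (i k : ι) :
    ∃ g ∈ G, g (a, i) = (c, k) ∧ g (b, i) = (d, k) := by
  have to_base : ∀ (a b : α) (i : ι), a ≠ b → ∃ g ∈ G, ∃ a' b' : α, a' ≠ b' ∧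
      g (a, i) = (a', i₀) ∧ g (b, i) = (b', i₀) := by
    intro a b i hab
    obtain ⟨x, hx, hxi⟩ := hX.exists_apply_eq i i₀
    obtain ⟨g, hg, hgx⟩ := (hproj x).1 hx
    have ha : g (a, i) = ((g (a, i)).1, i₀) := Prod.ext rfl ((hgx _).trans hxi)
    have hb : g (b, i) = ((g (b, i)).1, i₀) := Prod.ext rfl ((hgx _).trans hxi)
    refine ⟨g, hg, _, _, fun h => hab ?_, ha, hb⟩
    have : g (a, i) = g (b, i) := by rw [ha, hb, h]
    simpa using this
  obtain ⟨g, hg, a', b', hab', hga, hgb⟩ := to_base a b i hab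
  obtain ⟨h, hh, c', d', hcd', hhc, hhd⟩ := to_base c d k hcd
  obtain ⟨σ, hσ, hσa, hσb⟩ := hH.2 a' b' c' d' hab' hcd'
  obtain ⟨s, hs, hsσ⟩ := (hcomp σ).1 hσ
  refine ⟨h⁻¹ * (s * g), G.mul_mem (G.inv_mem hh) (G.mul_mem hs hg), ?_, ?_⟩
  · rw [Equiv.Perm.mul_apply, Equiv.Perm.inv_eq_iff_eq, hhc, Equiv.Perm.mul_apply, hga, hsσ, hσa]
  · rw [Equiv.Perm.mul_apply, Equiv.Perm.inv_eq_iff_eq, hhd, Equiv.Perm.mul_apply, hgb, hsσ, hσb]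

open Classical in
/-- The relative position of two points of `α × ι`: equal, distinct in a common block, or in
different blocks. -/
noncomputable def pairType {α ι : Type*} (P : (α × ι) × (α × ι)) : Fin 3 :=
  if P.1 = P.2 then 0 else if P.1.2 = P.2.2 then 1 else 2

theorem pairType_surjective (α ι : Type*) [Nontrivial α] [Nontrivial ι] :
    Function.Surjective (pairType : (α × ι) × (α × ι) → Fin 3) := by
  obtain ⟨a, b, hab⟩ := exists_pair_ne α
  obtain ⟨i, j, hij⟩ := exists_pair_ne ι
  intro k
  fin_cases k
  · exact ⟨((a, i), (a, i)), by simp [pairType]⟩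
  · exact ⟨((a, i), (b, i)), by simp [pairType, hab]⟩
  · exact ⟨((a, i), (a, j)), by simp [pairType, hij]⟩

theorem pairType_eq_two {α ι : Type*} {a b : α} {i j : ι} (hij : i ≠ j) :
    pairType ((a, i), (b, j)) = 2 := by
  simp [pairType, hij]

/-- The relative position separates the orbits on pairs if and only if all pairs of points in
different blocks form a single orbit. -/
theorem pairType_separates_iff {α ι : Type*} {H : Subgroup (Equiv.Perm α)}
    {X : Subgroup (Equiv.Perm ι)} (hH : Is2Trans H) (hX : Is2Trans X)
    {G : Subgroup (Equiv.Perm (α × ι))} (hproj : ProjEq G X) {i₀ : ι}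
    (hcomp : ComponentEq G i₀ H) :
    (∀ P Q : (α × ι) × (α × ι), pairType P = pairType Q → ∃ g : G, g • P = Q) ↔
      ∀ (a b c d : α) (i j k l : ι), i ≠ j → k ≠ l →
        ∃ g ∈ G, g (a, i) = (c, k) ∧ g (b, j) = (d, l) := by
  constructor
  · intro h a b c d i j k l hij hkl
    obtain ⟨g, hg⟩ := h ((a, i), (b, j)) ((c, k), (d, l))
      ((pairType_eq_two hij).trans (pairType_eq_two hkl).symm)
    exact ⟨g, g.2, congrArg Prod.fst hg, congrArg Prod.snd hg⟩
  · rintro h ⟨⟨a, i⟩, ⟨b, j⟩⟩ ⟨⟨c, k⟩, ⟨d, l⟩⟩ hPQ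
    suffices ∃ g ∈ G, g (a, i) = (c, k) ∧ g (b, j) = (d, l) by
      obtain ⟨g, hg, h₁, h₂⟩ := this
      exact ⟨⟨g, hg⟩, Prod.ext h₁ h₂⟩
    by_cases hij : i = j <;> by_cases hkl : k = l
    · subst hij hkl
      by_cases hab : a = b <;> by_cases hcd : c = d
      · subst hab hcd
        have := hH.1
        obtain ⟨b, hb⟩ := exists_ne a
        obtain ⟨d, hd⟩ := exists_ne c
        obtain ⟨g, hg, hgac, -⟩ :=
          exists_map_pair_of_same_block hH hX hproj hcomp hb.symm hd.symm i k
        exact ⟨g, hg, hgac, hgac⟩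
      · simp [pairType, hab, hcd] at hPQ
      · simp [pairType, hab, hcd] at hPQ
      · exact exists_map_pair_of_same_block hH hX hproj hcomp hab hcd i k
    · subst hij
      by_cases hab : a = b <;> simp [pairType, hab, hkl] at hPQ
    · subst hkl
      by_cases hcd : c = d <;> simp [pairType, hcd, hij] at hPQ
    · exact h a b c d i j k l hij hkl

/-- suppose `G` satisfies Hypothesis (*) with blocks `B × {i}`. Then `G`
has rank 3 if and only if (A) for all distinct blocks `Bᵢ, Bⱼ`, the stabiliser of both
blocks is transitive on `Bᵢ × Bⱼ`, and (B) for every block `Bᵢ` and `v ∈ Bᵢ`, the point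
stabiliser `G_v` is transitive on the remaining blocks. -/
theorem stmt_14 {B : Type*} [Fintype B] {n : ℕ} (hn : 2 ≤ n)
    (H : Subgroup (Equiv.Perm B)) (X : Subgroup (Equiv.Perm (Fin n)))
    (hH : Is2Trans H) (hX : Is2Trans X)
    (G : Subgroup (Equiv.Perm (B × Fin n)))
    (hGw : ∀ g ∈ G, InWreath H X g)
    (hproj : ProjEq G X)
    (hcomp : ComponentEq G (⟨0, by omega⟩ : Fin n) H) :
    Nat.card (MulAction.orbitRel.Quotient G ((B × Fin n) × (B × Fin n))) = 3 ↔
    ((∀ i j : Fin n, i ≠ j → ∀ a a' b b' : B,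
        ∃ g ∈ G, g (a, i) = (a', i) ∧ g (b, j) = (b', j)) ∧
     (∀ (i : Fin n) (v : B) (j k : Fin n), j ≠ i → k ≠ i →
        ∃ g ∈ G, g (v, i) = (v, i) ∧ ∀ b : B, (g (b, j)).2 = k)) := by
  have := hH.1
  have := hX.1
  have hinv : ∀ (g : G) (P : (B × Fin n) × (B × Fin n)), pairType (g • P) = pairType P := by
    rintro ⟨g, hg⟩ ⟨p, q⟩
    change pairType (g p, g q) = pairType (p, q)
    have h := (hGw g hg).snd_eq_iff p q
    by_cases hpq : p = q <;> by_cases hpq₂ : p.2 = q.2 <;> simp [pairType, h, hpq, hpq₂]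
  have hcard := card_orbits_eq_card_iff pairType hinv (pairType_surjective B (Fin n))
  rw [Nat.card_fin] at hcard
  rw [hcard, pairType_separates_iff hH hX hproj hcomp]
  constructor
  · intro h
    refine ⟨fun i j hij a a' b b' => h a b a' b' i j i j hij hij, fun i v j k hji hki => ?_⟩
    obtain ⟨g, hg, hgv, hgk⟩ := h v v v v i j i k hji.symm hki.symm
    refine ⟨g, hg, hgv, fun b => ?_⟩
    rw [((hGw g hg).snd_eq_iff (b, j) (v, j)).2 rfl, hgk]
  · rintro ⟨hA, hB⟩ a b c d i j k l hij hkl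
    obtain ⟨a', ha'⟩ := exists_ne a
    obtain ⟨c', hc'⟩ := exists_ne c
    obtain ⟨g, hg, hgc, -⟩ :=
      exists_map_pair_of_same_block hH hX hproj hcomp ha'.symm hc'.symm i k
    obtain ⟨b₁, j₁, hb₁⟩ : ∃ b₁ j₁, g (b, j) = (b₁, j₁) := ⟨_, _, rfl⟩
    have hj₁ : j₁ ≠ k := by
      have := (hGw g hg).snd_eq_iff (b, j) (a, i)
      rw [hb₁, hgc] at this
      exact fun h => hij (this.1 h).symm
    obtain ⟨s, hs, hsc, hsl⟩ := hB k c j₁ l hj₁ hkl.symm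
    have hsb : s (b₁, j₁) = ((s (b₁, j₁)).1, l) := Prod.ext rfl (hsl b₁)
    obtain ⟨t, ht, htc, htd⟩ := hA k l hkl c c (s (b₁, j₁)).1 d
    refine ⟨t * (s * g), G.mul_mem ht (G.mul_mem hs hg), ?_, ?_⟩
    · simp only [Equiv.Perm.mul_apply, hgc, hsc, htc]
    · rw [Equiv.Perm.mul_apply, Equiv.Perm.mul_apply, hb₁, hsb, htd]
end

section
/- Suppose that G ≤ Sym(Ω) satisfies Hypothesis (*), with system of imprimitivity 𝓑 consisting of n blocks of size m, and that G has rank 3. Then for all distinct blocks B, B′ ∈ 𝓑: (C) m² divides |G_{B,B′}|; and (D) G_{B,B′} admits at least two non-isomorphic transitive actions on m points, i.e., there exist subgroups of index m in G_{B,B′} that are not conjugate in G_{B,B′}. -/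
open Pointwise in
/-- The setwise stabiliser in `Sym(B × Fin n)` of the block `B × {i}`. -/
def blockStab (B : Type*) {n : ℕ} (i : Fin n) : Subgroup (Equiv.Perm (B × Fin n)) :=
  MulAction.stabilizer (Equiv.Perm (B × Fin n)) ({p : B × Fin n | p.2 = i} : Set (B × Fin n))

/-- The relation between two points of `α × ι`: equal (`0`), distinct in the same block (`1`),
or in different blocks (`2`). -/
noncomputable def blockRelation {α ι : Type*} (z : (α × ι) × (α × ι)) : Fin 3 :=
  open Classical in if z.1 = z.2 then 0 else if z.1.2 = z.2.2 then 1 else 2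

theorem blockRelation_smul {α ι : Type*} {H : Subgroup (Equiv.Perm α)}
    {X : Subgroup (Equiv.Perm ι)} {g : Equiv.Perm (α × ι)} (hg : InWreath H X g)
    (z : (α × ι) × (α × ι)) : blockRelation (g • z) = blockRelation z := by
  have h₁ : g z.1 = g z.2 ↔ z.1 = z.2 := g.injective.eq_iff
  have h₂ := hg.snd_eq_iff z.1 z.2
  simp only [blockRelation, Prod.smul_fst, Prod.smul_snd, Equiv.Perm.smul_def]
  split_ifs <;> tauto

theorem blockRelation_surjective {α ι : Type*} [Nontrivial α] [Nontrivial ι] :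
    Function.Surjective (blockRelation : (α × ι) × (α × ι) → Fin 3) := by
  obtain ⟨a, b, hab⟩ := exists_pair_ne α
  obtain ⟨i, j, hij⟩ := exists_pair_ne ι
  intro k
  fin_cases k
  · exact ⟨((a, i), (a, i)), by simp [blockRelation]⟩
  · exact ⟨((a, i), (b, i)), by simp [blockRelation, hab]⟩
  · exact ⟨((a, i), (a, j)), by simp [blockRelation, hij]⟩

/-- A block-preserving group of rank 3 is transitive on pairs of points in different blocks. -/
theorem exists_mem_map_pair_of_rank_three {α ι : Type*} [Nontrivial α] [Nontrivial ι]
    {H : Subgroup (Equiv.Perm α)} {X : Subgroup (Equiv.Perm ι)}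
    {G : Subgroup (Equiv.Perm (α × ι))} (hG : ∀ g ∈ G, InWreath H X g)
    (hrank : Nat.card (MulAction.orbitRel.Quotient G ((α × ι) × (α × ι))) = 3)
    {p q r s : α × ι} (hpq : p.2 ≠ q.2) (hrs : r.2 ≠ s.2) :
    ∃ g ∈ G, g p = r ∧ g q = s := by
  let f : MulAction.orbitRel.Quotient G ((α × ι) × (α × ι)) → Fin 3 :=
    Quotient.lift blockRelation (by
      rintro _ z ⟨g, rfl⟩
      exact blockRelation_smul (hG g g.2) z)
  have hf : Function.Surjective f := fun k =>
    let ⟨z, hz⟩ := blockRelation_surjective (α := α) (ι := ι) k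
    ⟨Quotient.mk _ z, hz⟩
  have : Finite (MulAction.orbitRel.Quotient G ((α × ι) × (α × ι))) :=
    Nat.finite_of_card_ne_zero (by omega)
  have hinj : Function.Injective f :=
    (hf.bijective_of_nat_card_le (by simp [hrank])).injective
  have hne : ∀ {u v : α × ι}, u.2 ≠ v.2 → blockRelation (u, v) = 2 := by
    intro u v huv
    have : u ≠ v := fun h => huv (h ▸ rfl)
    simp [blockRelation, huv, this]
  obtain ⟨g, hg⟩ : (r, s) ∈ MulAction.orbit G (p, q) :=
    MulAction.orbitRel_apply.mp <| Quotient.exact <|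
      hinj (a₁ := Quotient.mk _ (r, s)) (a₂ := Quotient.mk _ (p, q)) <|
        (hne hrs).trans (hne hpq).symm
  exact ⟨g, g.2, congrArg Prod.fst hg, congrArg Prod.snd hg⟩

open Pointwise in
theorem snd_eq_of_mem_blockStab {B : Type*} {n : ℕ} {i : Fin n} {g : Equiv.Perm (B × Fin n)}
    (hg : g ∈ blockStab B i) {p : B × Fin n} (hp : p.2 = i) : (g p).2 = i := by
  have h : g • {p : B × Fin n | p.2 = i} = {p : B × Fin n | p.2 = i} := hg
  have : g p ∈ g • {p : B × Fin n | p.2 = i} := Set.smul_mem_smul_set hp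
  rwa [h] at this

open Pointwise in
theorem InWreath.mem_blockStab {B : Type*} {n : ℕ} {H : Subgroup (Equiv.Perm B)}
    {X : Subgroup (Equiv.Perm (Fin n))} {g : Equiv.Perm (B × Fin n)} (hg : InWreath H X g)
    {i : Fin n} {p : B × Fin n} (hp : p.2 = i) (hgp : (g p).2 = i) : g ∈ blockStab B i := by
  have key : ∀ q, (g q).2 = i ↔ q.2 = i := fun q => by
    rw [← hgp, hg.snd_eq_iff, hp, hgp]
  refine MulAction.mem_stabilizer_iff.mpr (Set.ext fun q => ?_)
  rw [Set.mem_smul_set_iff_inv_smul_mem]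
  simpa using (key (g⁻¹ q)).symm

theorem ncard_setOf_snd_eq {B : Type*} {n : ℕ} (i : Fin n) :
    {p : B × Fin n | p.2 = i}.ncard = Nat.card B := by
  rw [← Set.ncard_range_of_injective (Prod.mk_left_injective i : Function.Injective (·, i))]
  congr 1
  ext ⟨b, k⟩
  simp [eq_comm]

/-- suppose `G` satisfies Hypothesis (*) with `n` blocks `B × {i}` of size
`m = |B|`, and `G` has rank 3. Then for distinct blocks `Bᵢ, Bⱼ`: (C) `m²` divides the
order of the two-block stabiliser `G_{Bᵢ,Bⱼ}`; and (D) `G_{Bᵢ,Bⱼ}` has at least two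
non-isomorphic transitive actions on `m` points: there are two subgroups of index `m`
in `G_{Bᵢ,Bⱼ}` that are not conjugate in `G_{Bᵢ,Bⱼ}`. -/
theorem stmt_15 {B : Type*} [Fintype B] {n : ℕ} (hn : 2 ≤ n)
    (H : Subgroup (Equiv.Perm B)) (X : Subgroup (Equiv.Perm (Fin n)))
    (hH : Is2Trans H) (hX : Is2Trans X)
    (G : Subgroup (Equiv.Perm (B × Fin n)))
    (hGw : ∀ g ∈ G, InWreath H X g)
    (hproj : ProjEq G X)
    (hcomp : ComponentEq G (⟨0, by omega⟩ : Fin n) H)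
    (hrank3 : Nat.card
      (MulAction.orbitRel.Quotient G ((B × Fin n) × (B × Fin n))) = 3)
    (i j : Fin n) (hij : i ≠ j) :
    (Nat.card B) ^ 2 ∣ Nat.card ↥(G ⊓ blockStab B i ⊓ blockStab B j) ∧
    ∃ K₁ K₂ : Subgroup ↥(G ⊓ blockStab B i ⊓ blockStab B j),
      K₁.index = Nat.card B ∧ K₂.index = Nat.card B ∧
      ∀ g : ↥(G ⊓ blockStab B i ⊓ blockStab B j),
        Subgroup.map (MulAut.conj g).toMonoidHom K₁ ≠ K₂ := by
  have : Nontrivial B := hH.1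
  have : Nontrivial (Fin n) := ⟨i, j, hij⟩
  set L := G ⊓ blockStab B i ⊓ blockStab B j with hL
  have htrans : ∀ b c b' c' : B, ∃ g : L, g • (b, i) = (b', i) ∧ g • (c, j) = (c', j) := by
    intro b c b' c'
    obtain ⟨g, hg, h₁, h₂⟩ := exists_mem_map_pair_of_rank_three hGw hrank3
      (p := (b, i)) (q := (c, j)) (r := (b', i)) (s := (c', j)) hij hij
    have hw := hGw g hg
    exact ⟨⟨g, ⟨hg, hw.mem_blockStab rfl (by rw [h₁])⟩, hw.mem_blockStab rfl (by rw [h₂])⟩,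
      h₁, h₂⟩
  have hLi : ∀ (g : L) (p : B × Fin n), p.2 = i → (g • p).2 = i :=
    fun g p hp => snd_eq_of_mem_blockStab g.2.1.2 hp
  have hLj : ∀ (g : L) (p : B × Fin n), p.2 = j → (g • p).2 = j :=
    fun g p hp => snd_eq_of_mem_blockStab g.2.2 hp
  obtain ⟨b, b', hbb'⟩ := exists_pair_ne B
  have horb : MulAction.orbit L ((b, i), (b, j)) =
      {p : B × Fin n | p.2 = i} ×ˢ {p : B × Fin n | p.2 = j} := by
    ext ⟨⟨c, k⟩, ⟨d, l⟩⟩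
    constructor
    · rintro ⟨g, hg⟩
      exact hg ▸ ⟨hLi g _ rfl, hLj g _ rfl⟩
    · rintro ⟨rfl : k = i, rfl : l = j⟩
      obtain ⟨g, h₁, h₂⟩ := htrans b b c d
      exact ⟨g, Prod.ext h₁ h₂⟩
  have horbi : MulAction.orbit L (b, i) = {p : B × Fin n | p.2 = i} := by
    ext ⟨c, k⟩
    constructor
    · rintro ⟨g, hg⟩
      exact hg ▸ hLi g _ rfl
    · rintro (rfl : k = i)
      obtain ⟨g, h, -⟩ := htrans b b c b
      exact ⟨g, h⟩
  have horbj : MulAction.orbit L (b, j) = {p : B × Fin n | p.2 = j} := by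
    ext ⟨c, k⟩
    constructor
    · rintro ⟨g, hg⟩
      exact hg ▸ hLj g _ rfl
    · rintro (rfl : k = j)
      obtain ⟨g, -, h⟩ := htrans b b b c
      exact ⟨g, h⟩
  refine ⟨?_, MulAction.stabilizer L (b, i), MulAction.stabilizer L (b, j), ?_, ?_, ?_⟩
  · have h := (MulAction.stabilizer L ((b, i), (b, j))).index_dvd_card
    rwa [MulAction.index_stabilizer, horb, Set.ncard_prod, ncard_setOf_snd_eq,
      ncard_setOf_snd_eq, ← sq] at h
  · rw [MulAction.index_stabilizer, horbi, ncard_setOf_snd_eq]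
  · rw [MulAction.index_stabilizer, horbj, ncard_setOf_snd_eq]
  · intro g hg
    rw [← MulAction.stabilizer_smul_eq_stabilizer_map_conj] at hg
    obtain ⟨c, hc⟩ : ∃ c, g • (b, i) = (c, i) := ⟨_, Prod.ext rfl (hLi g _ rfl)⟩
    obtain ⟨d, hd⟩ := exists_ne c
    obtain ⟨k, hk, hkj⟩ := htrans c b d b
    have hmem : k ∈ MulAction.stabilizer L (g • (b, i)) := hg ▸ hkj
    rw [hc, MulAction.mem_stabilizer_iff, hk] at hmem
    exact hd (congrArg Prod.fst hmem)
end
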